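/- arXiv:1801.01482 — 2 statements merged into one kernel-verified Lean document; each statement's English description precedes it below -/
import Mathlib

section
/- An n-element finite meet-semilattice S satisfies |Con(S)| = 28·2^{n-6} if and only if S is a quasi-tree semilattice whose nucleus is the four-element boolean lattice. -/
def IsMeetCong {α : Type*} [SemilatticeInf α] (s : Setoid α) : Prop :=
  ∀ a b c d : α, s.r a b → s.r c d → s.r (a ⊓ c) (b ⊓ d)

noncomputable def numCong (α : Type*) [SemilatticeInf α] : ℕ :=
  Nat.card {s : Setoid α // IsMeetCong s}

def IsUbta {α : Type*} [SemilatticeInf α] [OrderBot α] (x y : α) : Prop :=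
  x ≠ ⊥ ∧ y ≠ ⊥ ∧ ¬ x ≤ y ∧ ¬ y ≤ x ∧ ∃ z, x ≤ z ∧ y ≤ z

def treeCong (α : Type*) [SemilatticeInf α] [OrderBot α] : Setoid α :=
  sInf {s : Setoid α | IsMeetCong s ∧
    ∀ a b v : α, IsUbta a b → IsLUB {a, b} v → s.r (a ⊓ b) v}

def IsNucleus {α : Type*} [SemilatticeInf α] [OrderBot α] (X : Set α) : Prop :=
  (∃ x ∈ X, ∃ y ∈ X, x ≠ y) ∧
  (∀ x ∈ X, ∀ y, y ∈ X ↔ (treeCong α).r x y) ∧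
  (∀ a b : α, (treeCong α).r a b → a ≠ b → a ∈ X)

def IsQuasiTree (α : Type*) [SemilatticeInf α] [OrderBot α] : Prop :=
  ∃ X : Set α, IsNucleus X

/-- X is a copy of the four-element boolean lattice {u, a, b, v}. -/
def IsB4Nucleus {α : Type*} [SemilatticeInf α] (X : Set α) : Prop :=
  ∃ u a b v : α, X = {u, a, b, v} ∧ ¬ a ≤ b ∧ ¬ b ≤ a ∧
    a ⊓ b = u ∧ IsLUB {a, b} v

open Finset in
theorem exists_isLUB_pair_of_le {α : Type*} [SemilatticeInf α] [Fintype α] {a b z : α}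
    (ha : a ≤ z) (hb : b ≤ z) : ∃ v, IsLUB {a, b} v := by
  classical
  have hne : (univ.filter fun x : α => a ≤ x ∧ b ≤ x).Nonempty := ⟨z, by simp [ha, hb]⟩
  refine ⟨(univ.filter fun x : α => a ≤ x ∧ b ≤ x).inf' hne id, ?_, ?_⟩
  · rintro x (rfl | rfl)
    · exact le_inf' _ _ fun y hy => (mem_filter.1 hy).2.1
    · exact le_inf' _ _ fun y hy => (mem_filter.1 hy).2.2
  · intro y hy
    exact inf'_le (f := id) (mem_filter.2 ⟨mem_univ _, hy (by simp), hy (by simp)⟩)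

/-- The finite sets that contain `⊥` and all existing joins of pairs of their elements. -/
def IsJoinClosed {α : Type*} [SemilatticeInf α] [OrderBot α] (A : Finset α) : Prop :=
  ⊥ ∈ A ∧ ∀ a ∈ A, ∀ b ∈ A, ∀ v, IsLUB {a, b} v → v ∈ A

/-- Two elements are related when they lie above the same elements of `A`. -/
def setoidOfFinset {α : Type*} [SemilatticeInf α] (A : Finset α) : Setoid α where
  r x y := ∀ a ∈ A, a ≤ x ↔ a ≤ y
  iseqv := ⟨fun _ _ _ => Iff.rfl, fun h a ha => (h a ha).symm,
    fun h k a ha => (h a ha).trans (k a ha)⟩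

theorem isMeetCong_setoidOfFinset {α : Type*} [SemilatticeInf α] (A : Finset α) :
    IsMeetCong (setoidOfFinset A) := by
  intro a b c d h k x hx
  rw [le_inf_iff, le_inf_iff, h x hx, k x hx]

open Classical in
/-- The elements whose principal filter is saturated under `s`. -/
noncomputable def saturated {α : Type*} [SemilatticeInf α] [Fintype α] (s : Setoid α) :
    Finset α :=
  Finset.univ.filter fun a => ∀ x y, s.r x y → a ≤ x → a ≤ y

theorem mem_saturated {α : Type*} [SemilatticeInf α] [Fintype α] {s : Setoid α} {a : α} :
    a ∈ saturated s ↔ ∀ x y, s.r x y → a ≤ x → a ≤ y := by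
  simp [saturated]

theorem isJoinClosed_saturated {α : Type*} [SemilatticeInf α] [OrderBot α] [Fintype α]
    (s : Setoid α) : IsJoinClosed (saturated s) := by
  refine ⟨mem_saturated.2 fun _ _ _ _ => bot_le, fun a ha b hb v hv => ?_⟩
  rw [mem_saturated] at *
  intro x y hxy hvx
  refine hv.2 ?_
  rintro c (rfl | rfl)
  · exact ha x y hxy ((hv.1 (by simp)).trans hvx)
  · exact hb x y hxy ((hv.1 (by simp)).trans hvx)

open Finset in
theorem exists_rel_mem_saturated {α : Type*} [SemilatticeInf α] [Fintype α] {s : Setoid α}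
    (hs : IsMeetCong s) (x : α) : ∃ a ∈ saturated s, a ≤ x ∧ s.r x a := by
  classical
  have hx : x ∈ univ.filter fun y => s.r x y := mem_filter.2 ⟨mem_univ _, s.refl x⟩
  have hleast : ∀ y, s.r x y → (univ.filter fun y => s.r x y).inf' ⟨x, hx⟩ id ≤ y :=
    fun y hy => inf'_le (f := id) (mem_filter.2 ⟨mem_univ _, hy⟩)
  have hrel : s.r x ((univ.filter fun y => s.r x y).inf' ⟨x, hx⟩ id) := by
    refine inf'_induction (p := fun y => s.r x y) _ _ (fun p hp q hq => ?_)
      fun y hy => (mem_filter.1 hy).2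
    simpa using hs x p x q hp hq
  generalize (univ.filter fun y => s.r x y).inf' ⟨x, hx⟩ id = a at hleast hrel
  refine ⟨a, mem_saturated.2 fun p q hpq hap => ?_, hleast x (s.refl x), hrel⟩
  have h := hs a a p q (s.refl a) hpq
  rw [inf_eq_left.2 hap] at h
  exact (hleast _ (s.trans hrel h)).trans inf_le_right

theorem setoidOfFinset_saturated {α : Type*} [SemilatticeInf α] [Fintype α] {s : Setoid α}
    (hs : IsMeetCong s) : setoidOfFinset (saturated s) = s := by
  ext x y
  constructor
  · intro h
    have key : ∀ x y, (∀ a ∈ saturated s, a ≤ x → a ≤ y) → s.r x (x ⊓ y) := by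
      intro x y h
      obtain ⟨a, ha, hax, hr⟩ := exists_rel_mem_saturated hs x
      have := hs x a y y hr (s.refl y)
      rw [inf_eq_left.2 (h a ha hax)] at this
      exact s.trans hr (s.symm this)
    have h₁ := key x y fun a ha => (h a ha).1
    have h₂ := key y x fun a ha => (h a ha).2
    rw [inf_comm] at h₂
    exact s.trans h₁ (s.symm h₂)
  · exact fun h a ha => ⟨mem_saturated.1 ha x y h, mem_saturated.1 ha y x (s.symm h)⟩

open Finset in
theorem saturated_setoidOfFinset {α : Type*} [SemilatticeInf α] [OrderBot α] [Fintype α]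
    {A : Finset α} (hA : IsJoinClosed A) : saturated (setoidOfFinset A) = A := by
  classical
  ext a
  rw [mem_saturated]
  constructor
  · intro h
    obtain ⟨m, hm⟩ := (A.filter (· ≤ a)).exists_maximal ⟨⊥, by simp [hA.1]⟩
    obtain ⟨hmA, hma⟩ := mem_filter.1 hm.1
    have ham : a ≤ m := by
      refine h a m (fun c hc => ⟨fun hca => ?_, fun hcm => hcm.trans hma⟩) le_rfl
      obtain ⟨j, hj⟩ := exists_isLUB_pair_of_le hca hma
      have hja : j ≤ a := hj.2 (by rintro x (rfl | rfl) <;> assumption)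
      have hjm : j ≤ m :=
        hm.2 (mem_filter.2 ⟨hA.2 c hc m hmA j hj, hja⟩) (hj.1 (by simp))
      exact (hj.1 (by simp)).trans hjm
    rwa [le_antisymm ham hma]
  · exact fun ha x y hxy => (hxy a ha).1

open Classical in
theorem numCong_eq_card_isJoinClosed (α : Type*) [SemilatticeInf α] [OrderBot α] [Fintype α] :
    numCong α = (Finset.univ.filter fun A : Finset α => IsJoinClosed A).card := by
  have e : {s : Setoid α // IsMeetCong s} ≃ {A : Finset α // IsJoinClosed A} :=
    { toFun := fun s => ⟨saturated s.1, isJoinClosed_saturated s.1⟩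
      invFun := fun A => ⟨setoidOfFinset A.1, isMeetCong_setoidOfFinset A.1⟩
      left_inv := fun s => Subtype.ext (setoidOfFinset_saturated s.2)
      right_inv := fun A => Subtype.ext (saturated_setoidOfFinset A.2) }
  rw [numCong, Nat.card_congr e, Nat.card_eq_fintype_card, Fintype.card_subtype]

theorem IsUbta.of_not_le {α : Type*} [SemilatticeInf α] [OrderBot α] {a b v : α}
    (hab : ¬ a ≤ b) (hba : ¬ b ≤ a) (hv : IsLUB {a, b} v) : IsUbta a b := by
  refine ⟨?_, ?_, hab, hba, v, hv.1 (by simp), hv.1 (by simp)⟩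
  · rintro rfl; exact hab bot_le
  · rintro rfl; exact hba bot_le

theorem IsLUB.mem_pair_of_le {α : Type*} [SemilatticeInf α] {a b v : α} (hv : IsLUB {a, b} v)
    (h : a ≤ b ∨ b ≤ a) : v = a ∨ v = b := by
  have ha : a ≤ v := hv.1 (by simp)
  have hb : b ≤ v := hv.1 (by simp)
  rcases h with h | h
  · exact .inr (le_antisymm (hv.2 (by rintro x (rfl | rfl) <;> simp [h])) hb)
  · exact .inl (le_antisymm (hv.2 (by rintro x (rfl | rfl) <;> simp [h])) ha)

open Finset in
/-- The finite sets containing `⊥` which, if they contain `a` and `b`, also contain `v`. -/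
theorem card_filter_bot_mem_of_pair {α : Type*} [SemilatticeInf α] [OrderBot α] [Fintype α]
    [DecidableEq α] {a b v : α} (hab : ¬ a ≤ b) (hba : ¬ b ≤ a) (hv : IsLUB {a, b} v) :
    2 ^ 6 * (univ.filter fun A : Finset α => ⊥ ∈ A ∧ (a ∈ A → b ∈ A → v ∈ A)).card =
      28 * 2 ^ Fintype.card α := by
  obtain ⟨ha, hb, -⟩ := IsUbta.of_not_le hab hba hv
  have hav : a ≤ v := hv.1 (by simp)
  have hbv : b ≤ v := hv.1 (by simp)
  have hva : v ≠ a := by rintro rfl; exact hba hbv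
  have hvb : v ≠ b := by rintro rfl; exact hab hav
  have hv0 : v ≠ ⊥ := by rintro rfl; exact ha (le_bot_iff.1 hav)
  have hne : a ≠ b := by rintro rfl; exact hab le_rfl
  have hset : (univ.filter fun A : Finset α => ⊥ ∈ A ∧ (a ∈ A → b ∈ A → v ∈ A)) =
      Icc {⊥} univ \ Icc {⊥, a, b} (univ.erase v) := by
    ext A
    simp only [mem_filter, mem_univ, true_and, mem_sdiff, mem_Icc,
      singleton_subset_iff, subset_univ, and_true, insert_subset_iff, subset_erase]
    tauto
  have hc3 : ({⊥, a, b} : Finset α).card = 3 := by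
    rw [card_insert_of_notMem (by simp [ha.symm, hb.symm]), card_pair hne]
  have hsub : ({⊥, a, b} : Finset α) ⊆ univ.erase v := by
    rw [subset_erase]
    simp [hv0, hva, hvb]
  have h4 : 4 ≤ Fintype.card α := by
    have := card_le_card hsub
    rw [hc3, card_erase_of_mem (mem_univ v), card_univ] at this
    omega
  have hsub' : Icc {⊥, a, b} (univ.erase v) ⊆ Icc ({⊥} : Finset α) univ :=
    Icc_subset_Icc (by simp) (subset_univ _)
  rw [hset, card_sdiff_of_subset hsub', card_Icc_finset (subset_univ _), card_Icc_finset hsub,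
    hc3, card_erase_of_mem (mem_univ v), card_singleton, card_univ]
  obtain ⟨k, hk⟩ := Nat.exists_eq_add_of_le h4
  rw [hk, show 4 + k - 1 = k + 3 by omega, show k + 3 - 3 = k by omega, pow_add, pow_add]
  omega

open Finset in
theorem numCong_eq_28_iff_unique_ubta (α : Type*) [SemilatticeInf α] [OrderBot α] [Fintype α] :
    2 ^ 6 * numCong α = 28 * 2 ^ Fintype.card α ↔
      ∃ a b v : α, ¬ a ≤ b ∧ ¬ b ≤ a ∧ IsLUB {a, b} v ∧
        ∀ c d, IsUbta c d → c = a ∧ d = b ∨ c = b ∧ d = a := by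
  classical
  rw [numCong_eq_card_isJoinClosed]
  have hsub : ∀ a b v : α, IsLUB {a, b} v →
      (univ.filter fun A : Finset α => IsJoinClosed A) ⊆
        univ.filter fun A : Finset α => ⊥ ∈ A ∧ (a ∈ A → b ∈ A → v ∈ A) :=
    fun a b v hv A hA => by
      simp only [mem_filter, mem_univ, true_and] at hA ⊢
      exact ⟨hA.1, fun ha hb => hA.2 a ha b hb v hv⟩
  constructor
  · intro h
    have hex : ∃ a b : α, IsUbta a b := by
      by_contra! hno
      have hset : (univ.filter fun A : Finset α => IsJoinClosed A) = Icc {⊥} univ := by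
        ext A
        simp only [mem_filter, mem_univ, true_and, mem_Icc, singleton_subset_iff,
          subset_univ, and_true]
        refine ⟨fun hA => hA.1, fun h0 => ⟨h0, fun a ha b hb v hv => ?_⟩⟩
        have hcomp : a ≤ b ∨ b ≤ a := by
          by_contra! hc
          exact hno a b (.of_not_le hc.1 hc.2 hv)
        rcases hv.mem_pair_of_le hcomp with rfl | rfl <;> assumption
      rw [hset, card_Icc_finset (subset_univ _), card_singleton, card_univ] at h
      obtain ⟨k, hk⟩ := Nat.exists_eq_succ_of_ne_zero (Fintype.card_ne_zero (α := α))
      rw [hk, Nat.succ_sub_one, pow_succ 2 k] at h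
      have := Nat.two_pow_pos k
      omega
    obtain ⟨a, b, -, -, hab, hba, z, haz, hbz⟩ := hex
    obtain ⟨v, hv⟩ := exists_isLUB_pair_of_le haz hbz
    refine ⟨a, b, v, hab, hba, hv, fun c d hcd => ?_⟩
    have heq := eq_of_subset_of_card_le (hsub a b v hv) (by
      have := card_filter_bot_mem_of_pair hab hba hv
      omega)
    obtain ⟨ha, hb, -⟩ := IsUbta.of_not_le hab hba hv
    obtain ⟨hc, hd, hcd, hdc, z, hcz, hdz⟩ := hcd
    obtain ⟨w, hw⟩ := exists_isLUB_pair_of_le hcz hdz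
    have hcw : c ≤ w := hw.1 (by simp)
    have hdw : d ≤ w := hw.1 (by simp)
    by_contra hne
    have hmem : ({⊥, c, d} : Finset α) ∈
        univ.filter fun A : Finset α => ⊥ ∈ A ∧ (a ∈ A → b ∈ A → v ∈ A) := by
      simp only [mem_filter, mem_univ, true_and, mem_insert, mem_singleton, true_or, ha, hb,
        false_or]
      rintro (rfl | rfl) (rfl | rfl)
      · exact absurd le_rfl hab
      · exact absurd (.inl ⟨rfl, rfl⟩) hne
      · exact absurd (.inr ⟨rfl, rfl⟩) hne
      · exact absurd le_rfl hab
    rw [← heq, mem_filter] at hmem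
    have hwmem := hmem.2.2 c (by simp) d (by simp) w hw
    simp only [mem_insert, mem_singleton] at hwmem
    rcases hwmem with rfl | rfl | rfl
    · exact hc (le_bot_iff.1 hcw)
    · exact hdc hdw
    · exact hcd hcw
  · rintro ⟨a, b, v, hab, hba, hv, huniq⟩
    rw [← card_filter_bot_mem_of_pair hab hba hv]
    congr 2
    refine (hsub a b v hv).antisymm fun A hA => ?_
    simp only [mem_filter, mem_univ, true_and] at hA ⊢
    refine ⟨hA.1, fun c hc d hd w hw => ?_⟩
    by_cases hcomp : c ≤ d ∨ d ≤ c
    · rcases hw.mem_pair_of_le hcomp with rfl | rfl <;> assumption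
    · push Not at hcomp
      rcases huniq c d (.of_not_le hcomp.1 hcomp.2 hw) with ⟨rfl, rfl⟩ | ⟨rfl, rfl⟩
      · rw [hw.unique hv]
        exact hA.2 hc hd
      · rw [Set.pair_comm] at hw
        rw [hw.unique hv]
        exact hA.2 hd hc

theorem isMeetCong_treeCong (α : Type*) [SemilatticeInf α] [OrderBot α] :
    IsMeetCong (treeCong α) := by
  intro a b c d h k s hs
  exact hs.1 a b c d (h s hs) (k s hs)

theorem treeCong_inf_of_isLUB {α : Type*} [SemilatticeInf α] [OrderBot α] {a b v : α}
    (hab : ¬ a ≤ b) (hba : ¬ b ≤ a) (hv : IsLUB {a, b} v) : (treeCong α).r (a ⊓ b) v :=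
  fun _ hs => hs.2 a b v (.of_not_le hab hba hv) hv

/-- Blocks of a meet congruence are convex. -/
theorem IsMeetCong.rel_of_mem_Icc {α : Type*} [SemilatticeInf α] {s : Setoid α}
    (hs : IsMeetCong s) {u x v : α} (h : s.r u v) (hux : u ≤ x) (hxv : x ≤ v) : s.r u x := by
  have := hs u v x x h (s.refl x)
  rwa [inf_eq_left.2 hux, inf_eq_right.2 hxv] at this

/-- The equivalence relation whose only possible nonsingleton block is `X`. -/
def setoidCollapse {α : Type*} (X : Set α) : Setoid α where
  r x y := x = y ∨ x ∈ X ∧ y ∈ X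
  iseqv := by
    refine ⟨fun _ => .inl rfl, ?_, ?_⟩
    · rintro x y (rfl | h)
      · exact .inl rfl
      · exact .inr h.symm
    · rintro x y z (rfl | h) (rfl | k)
      · exact .inl rfl
      · exact .inr k
      · exact .inr h
      · exact .inr ⟨h.1, k.2⟩

theorem isMeetCong_setoidCollapse {α : Type*} [SemilatticeInf α] {X : Set α}
    (h : ∀ c, ∀ x ∈ X, ∀ y ∈ X, x ⊓ c = y ⊓ c ∨ x ⊓ c ∈ X ∧ y ⊓ c ∈ X) :
    IsMeetCong (setoidCollapse X) := by
  have hright : ∀ x y c, (setoidCollapse X).r x y →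
      (setoidCollapse X).r (x ⊓ c) (y ⊓ c) := by
    rintro x y c (rfl | hxy)
    · exact .inl rfl
    · exact h c x hxy.1 y hxy.2
  intro a b c d hab hcd
  refine (setoidCollapse X).trans (hright a b c hab) ?_
  rw [inf_comm b c, inf_comm b d]
  exact hright c d b hcd

theorem isMeetCong_setoidCollapse_of_unique_ubta {α : Type*} [SemilatticeInf α] [OrderBot α]
    {a b v : α} (hab : ¬ a ≤ b) (hba : ¬ b ≤ a) (hv : IsLUB {a, b} v)
    (huniq : ∀ c d, IsUbta c d → c = a ∧ d = b ∨ c = b ∧ d = a) :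
    IsMeetCong (setoidCollapse {a ⊓ b, a, b, v}) := by
  have hav : a ≤ v := hv.1 (by simp)
  have hbv : b ≤ v := hv.1 (by simp)
  have hcomp : ∀ c d, c ≤ v → d ≤ v → c ≤ d ∨ d ≤ c ∨ c = a ∧ d = b ∨ c = b ∧ d = a := by
    intro c d hc hd
    by_contra! h
    obtain ⟨h₁, h₂, h₃, h₄⟩ := h
    have hbot : ∀ x y : α, ¬ x ≤ y → x ≠ ⊥ := by
      rintro _ y h rfl
      exact h bot_le
    rcases huniq c d ⟨hbot _ _ h₁, hbot _ _ h₂, h₁, h₂, v, hc, hd⟩ with h | h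
    · exact h₃ h.1 h.2
    · exact h₄ h.1 h.2
  have hclass : ∀ w ≤ v, w ≤ a ⊓ b ∨ w = a ∨ w = b ∨ w = v := by
    intro w hw
    rcases hcomp w a hw hav with h | h | h | h
    · rcases hcomp w b hw hbv with k | k | k | k
      · exact .inl (le_inf h k)
      · exact absurd (k.trans h) hba
      · exact .inr (.inl k.1)
      · exact .inr (.inr (.inl k.1))
    · rcases hcomp w b hw hbv with k | k | k | k
      · exact absurd (h.trans k) hab
      · exact .inr (.inr (.inr (le_antisymm hw (hv.2 (by rintro x (rfl | rfl) <;> assumption)))))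
      · exact .inr (.inl k.1)
      · exact .inr (.inr (.inl k.1))
    · exact .inr (.inl h.1)
    · exact .inr (.inr (.inl h.1))
  have hX : ∀ x ∈ ({a ⊓ b, a, b, v} : Set α), a ⊓ b ≤ x ∧ x ≤ v := by
    rintro x (rfl | rfl | rfl | rfl)
    · exact ⟨le_rfl, inf_le_left.trans hav⟩
    · exact ⟨inf_le_left, hav⟩
    · exact ⟨inf_le_right, hbv⟩
    · exact ⟨inf_le_left.trans hav, le_rfl⟩
  refine isMeetCong_setoidCollapse fun c x hx y hy => ?_
  rcases hclass (v ⊓ c) inf_le_left with h | h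
  · have key : ∀ x ∈ ({a ⊓ b, a, b, v} : Set α), x ⊓ c = v ⊓ c := fun x hx =>
      le_antisymm (inf_le_inf_right c (hX x hx).2) (le_inf (h.trans (hX x hx).1) inf_le_right)
    exact .inl ((key x hx).trans (key y hy).symm)
  · have huc : a ⊓ b ≤ c := by
      refine (hX (v ⊓ c) ?_).1.trans inf_le_right
      rcases h with h | h | h <;> simp [h]
    have key : ∀ x ∈ ({a ⊓ b, a, b, v} : Set α),
        x ⊓ c ∈ ({a ⊓ b, a, b, v} : Set α) := by
      intro x hx
      rcases hclass (x ⊓ c) (inf_le_left.trans (hX x hx).2) with k | k | k | k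
      · exact .inl (le_antisymm k (le_inf (hX x hx).1 huc))
      · simp [k]
      · simp [k]
      · simp [k]
    exact .inr ⟨key x hx, key y hy⟩

theorem exists_isB4Nucleus_iff_unique_ubta (α : Type*) [SemilatticeInf α] [OrderBot α]
    [Fintype α] :
    (∃ X : Set α, IsNucleus X ∧ IsB4Nucleus X) ↔
      ∃ a b v : α, ¬ a ≤ b ∧ ¬ b ≤ a ∧ IsLUB {a, b} v ∧
        ∀ c d, IsUbta c d → c = a ∧ d = b ∨ c = b ∧ d = a := by
  constructor
  · rintro ⟨X, ⟨-, hblock, honly⟩, _, a, b, v, hX, hab, hba, rfl, hv⟩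
    refine ⟨a, b, v, hab, hba, hv, ?_⟩
    rintro c d ⟨-, -, hcd, hdc, z, hcz, hdz⟩
    obtain ⟨w, hw⟩ := exists_isLUB_pair_of_le hcz hdz
    have hcw : c ≤ w := hw.1 (by simp)
    have hdw : d ≤ w := hw.1 (by simp)
    have hrel := treeCong_inf_of_isLUB hcd hdc hw
    have hmem : c ⊓ d ∈ X := honly _ _ hrel fun h =>
      hcd (hcw.trans (h ▸ inf_le_right))
    have hc : c ∈ X := (hblock _ hmem c).2
      ((isMeetCong_treeCong α).rel_of_mem_Icc hrel inf_le_left hcw)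
    have hd : d ∈ X := (hblock _ hmem d).2
      ((isMeetCong_treeCong α).rel_of_mem_Icc hrel inf_le_right hdw)
    have hav : a ≤ v := hv.1 (by simp)
    have hbv : b ≤ v := hv.1 (by simp)
    have huv : a ⊓ b ≤ v := inf_le_left.trans hav
    have hua : a ⊓ b ≤ a := inf_le_left
    have hub : a ⊓ b ≤ b := inf_le_right
    subst hX
    simp only [Set.mem_insert_iff, Set.mem_singleton_iff] at hc hd
    rcases hc with rfl | rfl | rfl | rfl <;> rcases hd with rfl | rfl | rfl | rfl <;>
      first
        | exact absurd le_rfl hcd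
        | contradiction
        | exact .inl ⟨rfl, rfl⟩
        | exact .inr ⟨rfl, rfl⟩
  · rintro ⟨a, b, v, hab, hba, hv, huniq⟩
    have hav : a ≤ v := hv.1 (by simp)
    have hbv : b ≤ v := hv.1 (by simp)
    have htc := isMeetCong_treeCong α
    have hrel := treeCong_inf_of_isLUB hab hba hv
    have hcollapse : ∀ x y, (treeCong α).r x y →
        (setoidCollapse {a ⊓ b, a, b, v}).r x y := by
      refine fun x y h =>
        h _ ⟨isMeetCong_setoidCollapse_of_unique_ubta hab hba hv huniq, fun c d w hcd hw => ?_⟩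
      rcases huniq c d hcd with ⟨rfl, rfl⟩ | ⟨rfl, rfl⟩
      · exact .inr ⟨by simp, by simp [hw.unique hv]⟩
      · rw [Set.pair_comm] at hw
        exact .inr ⟨by simp [inf_comm], by simp [hw.unique hv]⟩
    have hu : ∀ x ∈ ({a ⊓ b, a, b, v} : Set α), (treeCong α).r (a ⊓ b) x := by
      rintro x (rfl | rfl | rfl | rfl)
      · exact (treeCong α).refl _
      · exact htc.rel_of_mem_Icc hrel inf_le_left hav
      · exact htc.rel_of_mem_Icc hrel inf_le_right hbv
      · exact hrel
    refine ⟨{a ⊓ b, a, b, v}, ⟨⟨a, by simp, b, by simp, fun h => hab h.le⟩, fun x hx y => ?_,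
      fun x y h hne => ?_⟩, a ⊓ b, a, b, v, rfl, hab, hba, rfl, hv⟩
    · refine ⟨fun hy => (treeCong α).trans ((treeCong α).symm (hu x hx)) (hu y hy), fun h => ?_⟩
      rcases hcollapse x y h with rfl | h
      · exact hx
      · exact h.2
    · rcases hcollapse x y h with rfl | h
      · exact absurd rfl hne
      · exact h.1

/-- |Con(S)| = 28·2^(n-6) (multiplied through by 2^6) iff S is a quasi-tree
semilattice whose nucleus is the four-element boolean lattice. -/
theorem numCong_eq_28_iff {α : Type*} [SemilatticeInf α] [OrderBot α] [Fintype α]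
    (hn : 2 ≤ Fintype.card α) :
    2 ^ 6 * numCong α = 28 * 2 ^ Fintype.card α ↔
      ∃ X : Set α, IsNucleus X ∧ IsB4Nucleus X := by
  rw [numCong_eq_28_iff_unique_ubta, exists_isB4Nucleus_iff_unique_ubta]
end

section
/- The set of sizes of congruence lattices of 5-element meet-semilattices is exactly {16, 14, 13, 12}; in particular the meet-semilattice reduct of the lattice M₃ (five elements: bottom, three pairwise incomparable atoms, top) has exactly 12 congruences. -/
/-- Sending each element to the least element of its class identifies the meet congruences with
the maps satisfying this predicate. -/
def IsLeastRep {α : Type*} (m : α → α → α) (f : α → α) : Prop :=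
  (∀ x, m (f x) x = f x) ∧ ∀ x y, f (m (f x) y) = f (m x y)

instance {n : ℕ} (m : Fin n → Fin n → Fin n) : DecidablePred (IsLeastRep m) := fun f =>
  inferInstanceAs (Decidable ((∀ x, m (f x) x = f x) ∧ ∀ x y, f (m (f x) y) = f (m x y)))

namespace IsMeetCong

variable {α : Type*} [SemilatticeInf α]

theorem exists_least_rel [Finite α] {s : Setoid α} (hs : IsMeetCong s) (x : α) :
    ∃ z, s.r x z ∧ ∀ y, s.r x y → z ≤ y := by
  obtain ⟨z, hz⟩ := (Set.toFinite {y | s.r x y}).exists_minimal ⟨x, s.refl x⟩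
  refine ⟨z, hz.prop, fun y hy => ?_⟩
  have hzy : s.r x (z ⊓ y) := by simpa using hs x z x y hz.prop hy
  exact (hz.le_of_le hzy inf_le_left).trans inf_le_right

end IsMeetCong

namespace IsLeastRep

variable {α : Type*} [SemilatticeInf α] {f g : α → α}

theorem apply_le (hf : IsLeastRep (· ⊓ ·) f) (x : α) : f x ≤ x := inf_eq_left.1 (hf.1 x)

theorem apply_apply (hf : IsLeastRep (· ⊓ ·) f) (x : α) : f (f x) = f x := by
  simpa [hf.apply_le x] using hf.2 x x

theorem isMeetCong_ker (hf : IsLeastRep (· ⊓ ·) f) : IsMeetCong (Setoid.ker f) := by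
  intro a b c d hab hcd
  have key : ∀ x y, f (f x ⊓ f y) = f (x ⊓ y) := fun x y => by
    calc f (f x ⊓ f y) = f (x ⊓ f y) := hf.2 x (f y)
      _ = f (f y ⊓ x) := by rw [inf_comm]
      _ = f (y ⊓ x) := hf.2 y x
      _ = f (x ⊓ y) := by rw [inf_comm]
  have hab : f a = f b := hab
  have hcd : f c = f d := hcd
  change f (a ⊓ c) = f (b ⊓ d)
  rw [← key, hab, hcd, key]

theorem eq_of_ker_eq (hf : IsLeastRep (· ⊓ ·) f) (hg : IsLeastRep (· ⊓ ·) g)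
    (h : Setoid.ker f = Setoid.ker g) : f = g := by
  have hfg : ∀ x y, f x = f y ↔ g x = g y := fun x y => by
    rw [← Setoid.ker_def, h, Setoid.ker_def]
  funext x
  apply le_antisymm
  · rw [← (hfg _ _).2 (hg.apply_apply x)]
    exact hf.apply_le _
  · rw [← (hfg _ _).1 (hf.apply_apply x)]
    exact hg.apply_le _

end IsLeastRep

theorem IsMeetCong.exists_isLeastRep {α : Type*} [SemilatticeInf α] [Finite α] {s : Setoid α}
    (hs : IsMeetCong s) : ∃ f, IsLeastRep (· ⊓ ·) f ∧ Setoid.ker f = s := by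
  choose f hf hle using hs.exists_least_rel
  have hker : ∀ x y, f x = f y ↔ s.r x y := fun x y => by
    refine ⟨fun h => s.trans (hf x) (h ▸ s.symm (hf y)), fun h => le_antisymm ?_ ?_⟩
    · exact hle x _ (s.trans h (hf y))
    · exact hle y _ (s.trans (s.symm h) (hf x))
  refine ⟨f, ⟨fun x => inf_eq_left.2 (hle x x (s.refl x)), fun x y => ?_⟩, ?_⟩
  · exact (hker _ _).2 (hs _ _ _ _ (s.symm (hf x)) (s.refl y))
  · ext x y
    exact hker x y

theorem numCong_eq_card_isLeastRep (α : Type*) [SemilatticeInf α] [Finite α] :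
    numCong α = Nat.card {f : α → α // IsLeastRep (· ⊓ ·) f} := by
  refine (Nat.card_congr (Equiv.ofBijective
    (fun f => ⟨Setoid.ker f.1, f.2.isMeetCong_ker⟩) ⟨?_, ?_⟩)).symm
  · intro f g h
    exact Subtype.ext (f.2.eq_of_ker_eq g.2 (congrArg Subtype.val h))
  · rintro ⟨s, hs⟩
    obtain ⟨f, hf, rfl⟩ := hs.exists_isLeastRep
    exact ⟨⟨f, hf⟩, rfl⟩

theorem numCong_eq_card_of_equiv {α β : Type*} [SemilatticeInf α] [Finite α] (e : β ≃ α)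
    {m : β → β → β} (hm : ∀ i j, e (m i j) = e i ⊓ e j) :
    numCong α = Nat.card {f : β → β // IsLeastRep m f} := by
  rw [numCong_eq_card_isLeastRep]
  refine (Nat.card_congr ((e.arrowCongr e).subtypeEquiv fun f => ?_)).symm
  simp only [IsLeastRep, ← e.forall_congr_right (q := fun x => _ = _),
    ← e.forall_congr_right (q := fun x => ∀ _, _), Equiv.arrowCongr_apply, Function.comp_apply,
    Equiv.symm_apply_apply, ← hm, e.injective.eq_iff]

/-- A self-map of `Fin 5` fixing `0`, given by its other values. -/
def selfMap (p : Fin 5 × Fin 5 × Fin 5 × Fin 5) : Fin 5 → Fin 5 :=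
  ![0, p.1, p.2.1, p.2.2.1, p.2.2.2]

theorem selfMap_injective : Function.Injective selfMap := by
  rintro ⟨a, b, c, d⟩ ⟨a', b', c', d'⟩ h
  simpa [selfMap] using h

/-- The number of maps `f` with `IsLeastRep m f` lying below the identity. -/
def leastRepCount (m : Fin 5 → Fin 5 → Fin 5) : ℕ :=
  (({0, 1} ×ˢ {0, 1, 2} ×ˢ {0, 1, 2, 3} ×ˢ Finset.univ :
    Finset (Fin 5 × Fin 5 × Fin 5 × Fin 5)).filter fun p => IsLeastRep m (selfMap p)).card

theorem card_isLeastRep_eq_leastRepCount {m : Fin 5 → Fin 5 → Fin 5}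
    (hm : ∀ i j, m i j ≤ j) : Nat.card {f // IsLeastRep m f} = leastRepCount m := by
  rw [leastRepCount, ← Finset.card_map ⟨selfMap, selfMap_injective⟩]
  refine Nat.subtype_card _ fun f => ?_
  simp only [Finset.mem_map, Finset.mem_filter, Finset.mem_product, Finset.mem_insert,
    Finset.mem_singleton, Finset.mem_univ, Function.Embedding.coeFn_mk, and_true]
  constructor
  · rintro ⟨p, ⟨-, hp⟩, rfl⟩
    exact hp
  · intro hf
    have hle : ∀ x, f x ≤ x := fun x => hf.1 x ▸ hm _ _
    have hfe : selfMap (f 1, f 2, f 3, f 4) = f := by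
      funext i
      fin_cases i
      · exact (Fin.le_zero_iff.1 (hle 0)).symm
      all_goals rfl
    refine ⟨(f 1, f 2, f 3, f 4), ⟨?_, by rwa [hfe]⟩, hfe⟩
    have h1 := hle 1
    have h2 := hle 2
    have h3 := hle 3
    dsimp only
    omega

/-- The symmetric idempotent operation on `Fin 5` with absorbing element `0` and the given
remaining values at pairs `(1, 2)`, `(1, 3)`, `(1, 4)`, `(2, 3)`, `(2, 4)`, `(3, 4)`. -/
def meetTable (a b c d e f : Fin 5) : Fin 5 → Fin 5 → Fin 5 :=
  ![![0, 0, 0, 0, 0], ![0, 1, a, b, c], ![0, a, 2, d, e], ![0, b, d, 3, f], ![0, c, e, f, 4]]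

theorem leastRepCount_meetTable_mem : ∀ a : Fin 5, a ≤ 1 → ∀ b : Fin 5, b ≤ 1 →
    ∀ c : Fin 5, c ≤ 1 → ∀ d : Fin 5, d ≤ 2 → ∀ e : Fin 5, e ≤ 2 → ∀ f : Fin 5, f ≤ 3 →
    (∀ i j k, meetTable a b c d e f (meetTable a b c d e f i j) k =
      meetTable a b c d e f i (meetTable a b c d e f j k)) →
    leastRepCount (meetTable a b c d e f) ∈ ({16, 14, 13, 12} : Finset ℕ) := by
  decide +kernel

theorem eq_meetTable {m : Fin 5 → Fin 5 → Fin 5} (hidem : ∀ i, m i i = i)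
    (hcomm : ∀ i j, m i j = m j i) (hle : ∀ i j, m i j ≤ j) :
    m = meetTable (m 1 2) (m 1 3) (m 1 4) (m 2 3) (m 2 4) (m 3 4) := by
  have hzero : ∀ i, m i 0 = 0 := fun i => Fin.le_zero_iff.1 (hle i 0)
  funext i j
  fin_cases i <;> fin_cases j <;>
    first
    | rfl
    | exact hidem _
    | exact hzero _
    | exact hcomm _ _
    | exact (hcomm _ _).trans (hzero _)

theorem numCong_mem_of_card_eq_five (α : Type*) [SemilatticeInf α] [Fintype α]
    (hα : Fintype.card α = 5) : numCong α ∈ ({16, 14, 13, 12} : Set ℕ) := by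
  let : Fintype (LinearExtension α) := ‹Fintype α›
  let e : Fin 5 ≃ α := (Fintype.orderIsoFinOfCardEq (LinearExtension α) hα).toEquiv
  have he : ∀ i j, e i ≤ e j → i ≤ j := fun i j h =>
    (Fintype.orderIsoFinOfCardEq (LinearExtension α) hα).le_iff_le.1
      ((toLinearExtension : α →o LinearExtension α).monotone h)
  let m : Fin 5 → Fin 5 → Fin 5 := fun i j => e.symm (e i ⊓ e j)
  have hm : ∀ i j, e (m i j) = e i ⊓ e j := fun i j => e.apply_symm_apply _
  have hcomm : ∀ i j, m i j = m j i := fun i j => e.injective (by simp only [hm, inf_comm])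
  have hidem : ∀ i, m i i = i := fun i => e.injective (by simp only [hm, inf_idem])
  have hassoc : ∀ i j k, m (m i j) k = m i (m j k) := fun i j k =>
    e.injective (by simp only [hm, inf_assoc])
  have hright : ∀ i j, m i j ≤ j := fun i j => he _ _ ((hm i j).trans_le inf_le_right)
  have hleft : ∀ i j, m i j ≤ i := fun i j => hcomm i j ▸ hright j i
  rw [numCong_eq_card_of_equiv e hm, card_isLeastRep_eq_leastRepCount hright]
  have htab := eq_meetTable hidem hcomm hright
  have key := leastRepCount_meetTable_mem (m 1 2) (hleft _ _) (m 1 3) (hleft _ _)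
    (m 1 4) (hleft _ _) (m 2 3) (hleft _ _) (m 2 4) (hleft _ _) (m 3 4) (hleft _ _)
    (htab ▸ hassoc)
  rw [← htab] at key
  simpa using key

theorem exists_numCong_eq_leastRepCount (m : Fin 5 → Fin 5 → Fin 5) (hidem : ∀ i, m i i = i)
    (hcomm : ∀ i j, m i j = m j i) (hassoc : ∀ i j k, m (m i j) k = m i (m j k))
    (hle : ∀ i j, m i j ≤ j) :
    ∃ (α : Type) (i : SemilatticeInf α) (j : Fintype α),
      @Fintype.card α j = 5 ∧ @numCong α i = leastRepCount m := by
  let S : SemilatticeInf (Fin 5) := @SemilatticeInf.mk' _ ⟨m⟩ hcomm hassoc hidem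
  refine ⟨Fin 5, S, inferInstance, rfl, ?_⟩
  rw [@numCong_eq_card_of_equiv _ _ S _ (Equiv.refl _) m fun _ _ => rfl,
    card_isLeastRep_eq_leastRepCount hle]

theorem numCong_diamond {α : Type*} [SemilatticeInf α] [Fintype α] [BoundedOrder α] (a b c : α)
    (hα : Fintype.card α = 5) (hab : ¬ a ≤ b) (hba : ¬ b ≤ a) (hac : ¬ a ≤ c) (hca : ¬ c ≤ a)
    (hbc : ¬ b ≤ c) (hcb : ¬ c ≤ b) (hx : ∀ x : α, x = ⊥ ∨ x = ⊤ ∨ x = a ∨ x = b ∨ x = c) :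
    numCong α = 12 := by
  have hinf : ∀ x y : α, ¬ x ≤ y → ¬ y ≤ x → (x = a ∨ x = b ∨ x = c) →
      (y = a ∨ y = b ∨ y = c) → x ⊓ y = ⊥ := by
    intro x y hxy hyx hxm hym
    have h1 : x ⊓ y ≤ x := inf_le_left
    have h2 : x ⊓ y ≤ y := inf_le_right
    rcases hx (x ⊓ y) with h | h | h | h | h
    · exact h
    · rw [h] at h2
      exact absurd (le_top.trans h2) hxy
    all_goals
      rw [h] at h1 h2
      rcases hxm with rfl | rfl | rfl <;> rcases hym with rfl | rfl | rfl <;> contradiction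
  have hsurj : Function.Surjective ![⊥, a, b, c, ⊤] := fun x => by
    rcases hx x with rfl | rfl | rfl | rfl | rfl
    exacts [⟨0, rfl⟩, ⟨4, rfl⟩, ⟨1, rfl⟩, ⟨2, rfl⟩, ⟨3, rfl⟩]
  let : Fintype (LinearExtension α) := ‹Fintype α›
  let e : Fin 5 ≃ α := Equiv.ofBijective _
    ((Fintype.bijective_iff_surjective_and_card _).2 ⟨hsurj, by rw [hα, Fintype.card_fin]⟩)
  have hm : ∀ i j, e (meetTable 0 0 1 0 2 3 i j) = e i ⊓ e j := by
    have h12 : a ⊓ b = ⊥ := hinf a b hab hba (by simp) (by simp)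
    have h13 : a ⊓ c = ⊥ := hinf a c hac hca (by simp) (by simp)
    have h23 : b ⊓ c = ⊥ := hinf b c hbc hcb (by simp) (by simp)
    have h21 := (inf_comm b a).trans h12
    have h31 := (inf_comm c a).trans h13
    have h32 := (inf_comm c b).trans h23
    intro i j
    fin_cases i <;> fin_cases j <;> simp [e, meetTable, h12, h13, h23, h21, h31, h32]
  rw [numCong_eq_card_of_equiv e hm, card_isLeastRep_eq_leastRepCount (by decide)]
  decide +kernel

/-- NCSL(5) = {16, 14, 13, 12}, and the meet-semilattice reduct of M₃
(bottom, three pairwise incomparable atoms, top) has exactly 12 congruences. -/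
theorem ncsl_five :
    (∀ (α : Type) [SemilatticeInf α] [Fintype α],
      Fintype.card α = 5 → numCong α ∈ ({16, 14, 13, 12} : Set ℕ)) ∧
    (∀ k ∈ ({16, 14, 13, 12} : Set ℕ),
      ∃ (α : Type) (i : SemilatticeInf α) (j : Fintype α),
        @Fintype.card α j = 5 ∧ @numCong α i = k) ∧
    (∀ (α : Type) [SemilatticeInf α] [Fintype α] [BoundedOrder α] (a b c : α),
      Fintype.card α = 5 →
      ¬ a ≤ b → ¬ b ≤ a → ¬ a ≤ c → ¬ c ≤ a → ¬ b ≤ c → ¬ c ≤ b →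
      (∀ x : α, x = ⊥ ∨ x = ⊤ ∨ x = a ∨ x = b ∨ x = c) →
      numCong α = 12) := by
  refine ⟨fun α _ _ hα => numCong_mem_of_card_eq_five α hα, ?_,
    fun α _ _ _ a b c => numCong_diamond a b c⟩
  rintro k (rfl | rfl | rfl | rfl)
  · rw [← show leastRepCount (meetTable 0 0 0 0 0 0) = 16 by decide +kernel]
    exact exists_numCong_eq_leastRepCount _ (by decide) (by decide) (by decide) (by decide)
  · rw [← show leastRepCount (meetTable 0 0 0 0 2 3) = 14 by decide +kernel]
    exact exists_numCong_eq_leastRepCount _ (by decide) (by decide) (by decide) (by decide)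
  · rw [← show leastRepCount (meetTable 0 0 1 2 2 3) = 13 by decide +kernel]
    exact exists_numCong_eq_leastRepCount _ (by decide) (by decide) (by decide) (by decide)
  · rw [← show leastRepCount (meetTable 0 0 1 0 2 3) = 12 by decide +kernel]
    exact exists_numCong_eq_leastRepCount _ (by decide) (by decide) (by decide) (by decide)
end
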